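/- arXiv:2602.10486 — 2 statements merged into one kernel-verified Lean document; each statement's English description precedes it below -/
import Mathlib

section
/- (All-pairs shortest paths via fair Floyd–Warshall relaxation.) Let E ⊆ Fin n × Fin n be the edge set of a directed graph with edge weights w : Fin n × Fin n → ℕ, and let T = max over edges of w. Let L = (Fin n → Fin n → {0,…,nT}) ordered componentwise and initialize G_0[i,j] = 0 if i = j, G_0[i,j] = w(i,j) if i ≠ j and (i,j) ∈ E, and G_0[i,j] = nT otherwise. For each pair (i,j) define f_{i,j} : L → L by f_{i,j}(G)[i,j] = min(G[i,j], min over k of (G[i,k] + G[k,j])) and leaving all other coordinates unchanged. Each f_{i,j} is deflationary, monotone, and (i,j)-local. For any fair schedule σ : ℕ → Fin n × Fin n, the execution G_{t+1} = f_{σ(t)}(G_t) from G_0 stabilizes at some G*, and for all vertices i, j: G*[i,j] = min(nT, d(i,j)), where d(i,j) is the minimum total weight of a directed walk from i to j in E (with d(i,i) = 0 via the empty walk, and G*[i,j] = nT if no walk from i to j exists). -/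
/-- The Floyd–Warshall relaxation update `f_{i,j}`: coordinate `(i,j)` becomes
`min (G i j, min over k of (G i k + G k j))`, all other coordinates are unchanged. -/
def fwRelax {n : ℕ} (i j : Fin n) (G : Fin n → Fin n → ℕ) : Fin n → Fin n → ℕ :=
  fun a b =>
    if a = i ∧ b = j then
      Finset.fold min (G i j) (fun k => G i k + G k j) Finset.univ
    else G a b

/-- The total weights of the directed walks from `i` to `j` with steps in `E`. -/
def walkWeights {V : Type*} (E : Finset (V × V)) (w : V × V → ℕ) (i j : V) : Set ℕ :=
  {W | ∃ l, ∃ c : ℕ → V, c 0 = i ∧ c l = j ∧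
    (∀ u < l, (c u, c (u + 1)) ∈ E) ∧
    W = ∑ u ∈ Finset.range l, w (c u, c (u + 1))}

section walkWeights

variable {V : Type*} {E : Finset (V × V)} {w : V × V → ℕ} {i j k : V}

lemma zero_mem_walkWeights : 0 ∈ walkWeights E w i i :=
  ⟨0, fun _ => i, rfl, rfl, by simp, by simp⟩

lemma mem_walkWeights_of_edge (h : (i, j) ∈ E) : w (i, j) ∈ walkWeights E w i j := by
  refine ⟨1, fun u => if u = 0 then i else j, by simp, by simp, ?_, by simp⟩
  intro u hu
  obtain rfl : u = 0 := by omega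
  simpa using h

lemma add_mem_walkWeights {a b : ℕ} (ha : a ∈ walkWeights E w i k)
    (hb : b ∈ walkWeights E w k j) : a + b ∈ walkWeights E w i j := by
  obtain ⟨l, c, h0, hl, hE, rfl⟩ := ha
  obtain ⟨m, e, e0, em, eE, rfl⟩ := hb
  have left : ∀ u ≤ l, (if u ≤ l then c u else e (u - l)) = c u := fun u hu => if_pos hu
  have right : ∀ u, (if l + u ≤ l then c (l + u) else e (l + u - l)) = e u := by
    intro u
    split_ifs with h
    · obtain rfl : u = 0 := by omega
      rw [Nat.add_zero, hl, e0]
    · rw [Nat.add_sub_cancel_left]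
  refine ⟨l + m, fun u => if u ≤ l then c u else e (u - l), ?_, ?_, ?_, ?_⟩
  · simpa using h0
  · exact (right m).trans em
  · intro u hu
    dsimp only
    rcases lt_or_ge u l with h | h
    · rw [left u h.le, left (u + 1) h]
      exact hE u h
    · obtain ⟨v, rfl⟩ := Nat.exists_eq_add_of_le h
      rw [right v, Nat.add_assoc, right (v + 1)]
      exact eE v (by omega)
  · rw [Finset.sum_range_add]
    dsimp only
    congr 1
    · refine Finset.sum_congr rfl fun u hu => ?_
      have hu := Finset.mem_range.1 hu
      rw [left u hu.le, left (u + 1) hu]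
    · refine Finset.sum_congr rfl fun u _ => ?_
      rw [right u, Nat.add_assoc, right (u + 1)]

/-- A nonnegative function vanishing on the diagonal, satisfying the triangle inequality and
bounded by the weight on every edge is bounded by the weight of every walk. -/
lemma le_of_mem_walkWeights {H : V → V → ℕ} (hdiag : ∀ a, H a a = 0)
    (hedge : ∀ a b, (a, b) ∈ E → H a b ≤ w (a, b))
    (htri : ∀ a b k, H a b ≤ H a k + H k b) {W : ℕ} (hW : W ∈ walkWeights E w i j) :
    H i j ≤ W := by
  obtain ⟨l, c, rfl, rfl, hE, rfl⟩ := hW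
  induction l with
  | zero => simp [hdiag]
  | succ l ih =>
    rw [Finset.sum_range_succ]
    exact (htri _ _ (c l)).trans
      (add_le_add (ih fun u hu => hE u (by omega)) (hedge _ _ (hE l (by omega))))

end walkWeights

section fwRelax

variable {n : ℕ} (i j : Fin n)

lemma fwRelax_le (H : Fin n → Fin n → ℕ) : fwRelax i j H ≤ H := by
  intro a b
  unfold fwRelax
  split_ifs with h
  · obtain ⟨rfl, rfl⟩ := h
    exact (Finset.le_fold_min _).1 le_rfl |>.1
  · exact le_rfl

lemma fwRelax_self_le (H : Fin n → Fin n → ℕ) (k : Fin n) :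
    fwRelax i j H i j ≤ H i k + H k j := by
  simp only [fwRelax, and_self, if_true]
  exact ((Finset.le_fold_min _).1 le_rfl).2 k (Finset.mem_univ k)

lemma fwRelax_monotone : Monotone (fwRelax i j) := by
  intro H K h a b
  unfold fwRelax
  split_ifs
  · rw [Finset.le_fold_min]
    have key := (Finset.le_fold_min
      (s := Finset.univ) (b := H i j) (f := fun k => H i k + H k j) _).1 le_rfl
    exact ⟨key.1.trans (h i j),
      fun k hk => (key.2 k hk).trans (add_le_add (h i k) (h k j))⟩
  · exact h a b

lemma fwRelax_eq_or (H : Fin n → Fin n → ℕ) (a b : Fin n) :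
    fwRelax i j H a b = H a b ∨ ∃ k, fwRelax i j H a b = H a k + H k b := by
  by_cases h : a = i ∧ b = j
  · obtain ⟨rfl, rfl⟩ := h
    simp only [fwRelax, and_self, if_true]
    have key := (Finset.fold_min_le (s := Finset.univ) (b := H a b)
      (f := fun k => H a k + H k b) _).1 le_rfl
    have key' := (Finset.le_fold_min
      (s := Finset.univ) (b := H a b) (f := fun k => H a k + H k b) _).1 le_rfl
    rcases key with h | ⟨k, hk, h⟩
    · exact .inl (le_antisymm key'.1 h)
    · exact .inr ⟨k, le_antisymm (key'.2 k hk) h⟩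
  · exact .inl (by simp only [fwRelax, if_neg h])

/-- Relaxation preserves being a walk weight or at least the cap `M`. -/
lemma le_or_mem_walkWeights_fwRelax {E : Finset (Fin n × Fin n)} {w : Fin n × Fin n → ℕ}
    {M : ℕ} {H : Fin n → Fin n → ℕ}
    (hH : ∀ a b, M ≤ H a b ∨ H a b ∈ walkWeights E w a b) (a b : Fin n) :
    M ≤ fwRelax i j H a b ∨ fwRelax i j H a b ∈ walkWeights E w a b := by
  rcases fwRelax_eq_or i j H a b with h | ⟨k, h⟩
  · rw [h]
    exact hH a b
  · rw [h]
    rcases hH a k with h₁ | h₁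
    · exact .inl (h₁.trans (Nat.le_add_right _ _))
    rcases hH k b with h₂ | h₂
    · exact .inl (h₂.trans (Nat.le_add_left _ _))
    exact .inr (add_mem_walkWeights h₁ h₂)

end fwRelax

lemma exists_forall_ge_eq_of_antitone {α : Type*} [PartialOrder α] [WellFoundedLT α]
    {f : ℕ → α} (hf : Antitone f) : ∃ N, ∀ t, N ≤ t → f t = f N := by
  obtain ⟨_, ⟨N, rfl⟩, hN⟩ :=
    (wellFounded_lt (α := α)).has_min (Set.range f) (Set.range_nonempty f)
  exact ⟨N, fun t ht => (hf ht).eq_of_not_lt (hN _ ⟨t, rfl⟩)⟩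

/-- All-pairs shortest paths via fair Floyd–Warshall relaxation: each
`fwRelax i j` is deflationary, monotone and `(i,j)`-local; a fair interleaved execution
from the initial state (`0` on the diagonal, edge weights on edges, else `n*T` where `T`
is the largest edge weight) stabilizes, and at stabilization coordinate `(i,j)` equals
`min (n*T) d(i,j)` where `d(i,j)` is the least total weight of a directed walk from `i`
to `j` (empty walks allowed), and equals `n*T` when no walk exists. -/
theorem stmt_15 {n : ℕ} (E : Finset (Fin n × Fin n)) (w : Fin n × Fin n → ℕ)
    (T : ℕ) (hT : T = E.sup w)
    (σ : ℕ → Fin n × Fin n) (hfair : ∀ p, {t | σ t = p}.Infinite)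
    (G : ℕ → Fin n → Fin n → ℕ)
    (hG0 : ∀ i j, G 0 i j =
      if i = j then 0 else if (i, j) ∈ E then w (i, j) else n * T)
    (hstep : ∀ t, G (t + 1) = fwRelax (σ t).1 (σ t).2 (G t)) :
    (∀ i j : Fin n, (∀ H : Fin n → Fin n → ℕ, fwRelax i j H ≤ H) ∧
        Monotone (fwRelax i j) ∧
        (∀ (H : Fin n → Fin n → ℕ) (a b : Fin n), ¬(a = i ∧ b = j) →
          fwRelax i j H a b = H a b)) ∧
    ∃ T', (∀ t, T' ≤ t → G t = G T') ∧
      ∀ i j : Fin n,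
        (∀ d, IsLeast {W | ∃ l, ∃ c : ℕ → Fin n, c 0 = i ∧ c l = j ∧
              (∀ u < l, (c u, c (u + 1)) ∈ E) ∧
              W = ∑ u ∈ Finset.range l, w (c u, c (u + 1))} d →
            G T' i j = min (n * T) d) ∧
        ({W | ∃ l, ∃ c : ℕ → Fin n, c 0 = i ∧ c l = j ∧
              (∀ u < l, (c u, c (u + 1)) ∈ E) ∧
              W = ∑ u ∈ Finset.range l, w (c u, c (u + 1))} = ∅ →
            G T' i j = n * T) := by
  refine ⟨fun i j => ⟨fwRelax_le i j, fwRelax_monotone i j,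
    fun H a b h => by simp only [fwRelax, if_neg h]⟩, ?_⟩
  have hanti : Antitone G := antitone_nat_of_succ_le fun t => hstep t ▸ fwRelax_le _ _ _
  obtain ⟨N, hN⟩ := exists_forall_ge_eq_of_antitone hanti
  refine ⟨N, hN, ?_⟩
  have htri : ∀ a b k, G N a b ≤ G N a k + G N k b := by
    intro a b k
    obtain ⟨t, ht, hlt⟩ := (hfair (a, b)).exists_gt N
    have h := hstep t
    rw [show σ t = (a, b) from ht, hN t hlt.le, hN (t + 1) (by omega)] at h
    calc G N a b = fwRelax a b (G N) a b := congrFun (congrFun h a) b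
      _ ≤ _ := fwRelax_self_le a b _ k
  have hle : ∀ a b, G N a b ≤ G 0 a b := fun a b => hanti (Nat.zero_le N) a b
  have hdiag : ∀ a, G N a a = 0 := fun a => by simpa [hG0] using hle a a
  have hedge : ∀ a b, (a, b) ∈ E → G N a b ≤ w (a, b) := by
    intro a b hab
    rcases eq_or_ne a b with rfl | hne
    · simp [hdiag]
    · simpa [hG0, hne, hab] using hle a b
  have hcap : ∀ a b, G N a b ≤ n * T := by
    intro a b
    by_cases hab : (a, b) ∈ E
    · calc G N a b ≤ w (a, b) := hedge a b hab
        _ ≤ T := hT ▸ Finset.le_sup hab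
        _ ≤ n * T := Nat.le_mul_of_pos_left T a.pos
    · rcases eq_or_ne a b with rfl | hne
      · simp [hdiag]
      · simpa [hG0, hne, hab] using hle a b
  have hinv : ∀ t a b, n * T ≤ G t a b ∨ G t a b ∈ walkWeights E w a b := by
    intro t
    induction t with
    | zero =>
      intro a b
      rw [hG0]
      split_ifs with h₁ h₂
      · subst h₁
        exact .inr zero_mem_walkWeights
      · exact .inr (mem_walkWeights_of_edge h₂)
      · exact .inl le_rfl
    | succ t ih =>
      rw [hstep]
      exact le_or_mem_walkWeights_fwRelax _ _ ih
  intro i j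
  change (∀ d, IsLeast (walkWeights E w i j) d → _) ∧ (walkWeights E w i j = ∅ → _)
  constructor
  · intro d hd
    refine le_antisymm (le_min (hcap i j) (le_of_mem_walkWeights hdiag hedge htri hd.1)) ?_
    rcases hinv N i j with h | h
    · exact (min_le_left _ _).trans h
    · exact (min_le_right _ _).trans (hd.2 h)
  · intro he
    rcases hinv N i j with h | h
    · exact le_antisymm (hcap i j) h
    · simp [he] at h
end

section
/- Let L = (Fin n → {0,…,m}) be ordered componentwise and let f_i : L → L be inflationary for every i ∈ S ⊆ Fin n. Suppose (G, S, (X_i)_{i∈S}, G') is a round with update-only-on-change semantics. If every f_i satisfies f_i(X_i) = X_i for all i ∈ S, then every read vector satisfies X_i = G and G' = G. Conversely, if some i ∈ S and coordinate j satisfy f_i(X_i) j ≠ X_i j, then G' j > G j. -/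
/-- A round with update-only-on-change semantics from state `G`, with active set `S`,
read vectors `X i` (for `i ∈ S`), and committed result `G'`.
A write to coordinate `j` by `i'` occurs exactly when `f i' (X i') j ≠ X i' j`. -/
def UpdateRound {n m : ℕ} (f : Fin n → (Fin n → Fin (m + 1)) → Fin n → Fin (m + 1))
    (S : Set (Fin n)) (G : Fin n → Fin (m + 1))
    (X : Fin n → Fin n → Fin (m + 1)) (G' : Fin n → Fin (m + 1)) : Prop :=
  (∀ i ∈ S, ∀ j, X i j = G j ∨
      ∃ i' ∈ S, f i' (X i') j ≠ X i' j ∧ X i j = f i' (X i') j) ∧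
  (∀ j, (∀ i ∈ S, f i (X i) j = X i j) → G' j = G j) ∧
  (∀ j, (∃ i ∈ S, f i (X i) j ≠ X i j) →
      ∃ i' ∈ S, f i' (X i') j ≠ X i' j ∧ G' j = f i' (X i') j)

/-- Every value read during a round is at least the value at the start of the round. -/
theorem UpdateRound.le_read {n m : ℕ}
    {f : Fin n → (Fin n → Fin (m + 1)) → Fin n → Fin (m + 1)} {S : Set (Fin n)}
    {G G' : Fin n → Fin (m + 1)} {X : Fin n → Fin n → Fin (m + 1)}
    (hround : UpdateRound f S G X G')
    (hinf : ∀ i ∈ S, ∀ H : Fin n → Fin (m + 1), H ≤ f i H)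
    {i : Fin n} (hi : i ∈ S) (j : Fin n) : G j ≤ X i j := by
  induction h : X i j using WellFoundedLT.induction generalizing i with
  | ind v ih =>
    subst h
    rcases hround.1 i hi j with h | ⟨i', hi', hne, h⟩
    · exact h.ge
    · have hlt : X i' j < X i j := h ▸ lt_of_le_of_ne (hinf i' hi' (X i') j) hne.symm
      exact (ih _ hlt hi' rfl).trans hlt.le

/-- A coordinate written during a round strictly increases. -/
theorem UpdateRound.lt_of_write {n m : ℕ}
    {f : Fin n → (Fin n → Fin (m + 1)) → Fin n → Fin (m + 1)} {S : Set (Fin n)}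
    {G G' : Fin n → Fin (m + 1)} {X : Fin n → Fin n → Fin (m + 1)}
    (hround : UpdateRound f S G X G')
    (hinf : ∀ i ∈ S, ∀ H : Fin n → Fin (m + 1), H ≤ f i H)
    {i : Fin n} (hi : i ∈ S) {j : Fin n} (hne : f i (X i) j ≠ X i j) : G j < G' j := by
  obtain ⟨i', hi', hne', h⟩ := hround.2.2 j ⟨i, hi, hne⟩
  rw [h]
  exact (hround.le_read hinf hi' j).trans_lt
    (lt_of_le_of_ne (hinf i' hi' (X i') j) hne'.symm)

/-- for a round with update-only-on-change semantics with inflationary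
functions, the round is stuck (`G' = G`) iff it is write-free; if all read vectors are
fixed points of their functions then every read vector equals `G` and `G' = G`;
and any write to coordinate `j` forces a strict increase `G j < G' j`. -/
theorem stmt_19 {n m : ℕ} (f : Fin n → (Fin n → Fin (m + 1)) → Fin n → Fin (m + 1))
    (S : Set (Fin n)) (hinf : ∀ i ∈ S, ∀ H : Fin n → Fin (m + 1), H ≤ f i H)
    (G G' : Fin n → Fin (m + 1)) (X : Fin n → Fin n → Fin (m + 1))
    (hround : UpdateRound f S G X G') :
    (G' = G ↔ ∀ i ∈ S, f i (X i) = X i) ∧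
    ((∀ i ∈ S, f i (X i) = X i) → (∀ i ∈ S, X i = G) ∧ G' = G) ∧
    (∀ i ∈ S, ∀ j, f i (X i) j ≠ X i j → G j < G' j) := by
  have hcommit : (∀ i ∈ S, f i (X i) = X i) → G' = G := fun h =>
    funext fun j => hround.2.1 j fun i hi => congrFun (h i hi) j
  refine ⟨⟨fun h i hi => funext fun j => ?_, hcommit⟩, fun h => ⟨fun i hi => funext fun j => ?_,
    hcommit h⟩, fun i hi j hne => hround.lt_of_write hinf hi hne⟩
  · by_contra hne
    exact (hround.lt_of_write hinf hi hne).ne' (congrFun h j)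
  · rcases hround.1 i hi j with hj | ⟨i', hi', hne, _⟩
    · exact hj
    · exact absurd (congrFun (h i' hi') j) hne
end
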